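/- For any complete extension E of the sequent-based ABA-framework, the set ass(E) of all assumptions occurring in the assumption components of arguments in E is consistent. -/

import Mathlib

/-- A rule `φ₁,…,φₙ → φ` of a deductive system: premises and a conclusion. -/
abbrev Rule (F : Type) := List F × F

/-- Deducibility `Γ ⊢^R φ`: chaining rules of `R` from members of `Γ`. -/
inductive Ded {F : Type} (R : Set (Rule F)) (Γ : Set F) : F → Prop
  | mem {φ : F} : φ ∈ Γ → Ded R Γ φ
  | app {l : List F} {φ : F} : (l, φ) ∈ R → (∀ ψ ∈ l, Ded R Γ ψ) → Ded R Γ φ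

/-- Derivability of assumptive sequents `A' ⟨ Γ ⇒ Δ` in the calculus `R_⇒`:
the sequents `μ(r)` for `r ∈ R`, the identity axiom, the two cut rules, and the
rules `AS_ABA` moving a formula of the assumption set `AS` between the
assumption component and the left-hand side of `⇒`. -/
inductive SeqDer {F : Type} [DecidableEq F] (R : Set (Rule F)) (AS : Set F) :
    Finset F → Finset F → Finset F → Prop
  | id (φ : F) : SeqDer R AS ∅ {φ} {φ}
  | mu {l : List F} {φ : F} : (l, φ) ∈ R → SeqDer R AS ∅ l.toFinset {φ}
  | cutLhs {A₁ A₂ Γ₁ Γ₂ Δ₁ Δ₂ : Finset F} {φ : F} :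
      SeqDer R AS A₁ Γ₁ (insert φ Δ₁) → SeqDer R AS A₂ (insert φ Γ₂) Δ₂ →
      SeqDer R AS (A₁ ∪ A₂) (Γ₁ ∪ Γ₂) (Δ₁ ∪ Δ₂)
  | cutAss {A₁ A₂ Γ₁ Γ₂ Δ₁ Δ₂ : Finset F} {φ : F} :
      SeqDer R AS A₁ Γ₁ (insert φ Δ₁) → SeqDer R AS (insert φ A₂) Γ₂ Δ₂ →
      SeqDer R AS (A₁ ∪ A₂) (Γ₁ ∪ Γ₂) (Δ₁ ∪ Δ₂)
  | toAss {A' Γ Δ : Finset F} {φ : F} :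
      φ ∈ AS → SeqDer R AS A' (insert φ Γ) Δ → SeqDer R AS (insert φ A') Γ Δ
  | toLhs {A' Γ Δ : Finset F} {φ : F} :
      φ ∈ AS → SeqDer R AS (insert φ A') Γ Δ → SeqDer R AS A' (insert φ Γ) Δ

/-- An argument: an assumption component, a support (strict premises) and a conclusion. -/
structure Argu (F : Type) where
  ass : Finset F
  supp : Finset F
  concl : F

/-- `a` is an ABA-argument based on `S` and `A`: a deduction `ass(a) ∪ supp(a) ⊢^R conc(a)`
with finite `ass(a) ⊆ A` and finite `supp(a) ⊆ S`. -/
def IsABAArg {F : Type} (R : Set (Rule F)) (S A : Set F) (a : Argu F) : Prop :=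
  ↑a.ass ⊆ A ∧ ↑a.supp ⊆ S ∧ Ded R (↑a.ass ∪ ↑a.supp) a.concl

/-- `a` is an assumptive sequent argument based on `S` and `A`: a sequent
`ass(a) ⟨ supp(a) ⇒ conc(a)` derivable in `R_⇒`, with `ass(a) ⊆ A` and `supp(a) ⊆ S`. -/
def IsSeqArg {F : Type} [DecidableEq F] (R : Set (Rule F)) (S A : Set F) (a : Argu F) : Prop :=
  ↑a.ass ⊆ A ∧ ↑a.supp ⊆ S ∧ SeqDer R A a.ass a.supp {a.concl}

/-- `a` attacks `b` iff the conclusion of `a` is the contrary of some assumption of `b`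
(this is the ABA attack, and also the sequent-based `AT_ABA` attack). -/
def Attacks {F : Type} (contrary : F → F) (a b : Argu F) : Prop :=
  ∃ ψ ∈ b.ass, a.concl = contrary ψ

/-- `E` is conflict-free: a set of arguments of the framework no member of which attacks a member. -/
def ConflictFree {α : Type} (Args : Set α) (att : α → α → Prop) (E : Set α) : Prop :=
  E ⊆ Args ∧ ∀ a ∈ E, ∀ b ∈ E, ¬ att a b

/-- `E` defends `a`: `E` attacks every attacker of `a`. -/
def Defends {α : Type} (Args : Set α) (att : α → α → Prop) (E : Set α) (a : α) : Prop :=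
  ∀ b ∈ Args, att b a → ∃ c ∈ E, att c b

/-- `E` is admissible: conflict-free and defending all of its elements. -/
def Admissible {α : Type} (Args : Set α) (att : α → α → Prop) (E : Set α) : Prop :=
  ConflictFree Args att E ∧ ∀ a ∈ E, Defends Args att E a

/-- A complete extension: an admissible set containing every argument it defends. -/
def CompleteExt {α : Type} (Args : Set α) (att : α → α → Prop) (E : Set α) : Prop :=
  Admissible Args att E ∧ ∀ a ∈ Args, Defends Args att E a → a ∈ E

/-- The grounded extension: the ⊆-minimal complete extension. -/
def GroundedExt {α : Type} (Args : Set α) (att : α → α → Prop) (E : Set α) : Prop :=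
  CompleteExt Args att E ∧ ∀ E', CompleteExt Args att E' → E ⊆ E'

/-- A preferred extension: a ⊆-maximal complete extension. -/
def PreferredExt {α : Type} (Args : Set α) (att : α → α → Prop) (E : Set α) : Prop :=
  CompleteExt Args att E ∧ ∀ E', CompleteExt Args att E' → E ⊆ E' → E' = E

/-- A set `A'` of assumptions is consistent iff there is no `φ ∈ A'` with
`A'' ∪ Γ ⊢^R φ̄` for some `A'' ⊆ A'` and `Γ ⊆ S`. -/
def ConsistentSet {F : Type} (R : Set (Rule F)) (contrary : F → F) (S : Set F)
    (A' : Set F) : Prop :=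
  ¬ ∃ φ ∈ A', ∃ A'' ⊆ A', ∃ Γ ⊆ S, Ded R (A'' ∪ Γ) (contrary φ)

/-- `MCS(S,A)`: the set of ⊆-maximal consistent subsets of `A`. -/
def MCS {F : Type} (R : Set (Rule F)) (contrary : F → F) (S A : Set F) : Set (Set F) :=
  {T | T ⊆ A ∧ ConsistentSet R contrary S T ∧
    ∀ T', T ⊆ T' → T' ⊆ A → ConsistentSet R contrary S T' → T' = T}

/-- `CN(T) = {φ | Γ ⊢^R φ for some Γ ⊆ T}`. -/
def CN {F : Type} (R : Set (Rule F)) (T : Set F) : Set F :=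
  {φ | ∃ Γ ⊆ T, Ded R Γ φ}

/-- `⊢^R` is contrapositive for assumptions: for all `φ, ψ` in an assumption set `A'`
and `Γ ⊆ S`, `A' ∪ Γ ⊢^R ψ̄` iff `(A' \ {φ}) ∪ {ψ} ∪ Γ ⊢^R φ̄`. -/
def Contrapositive {F : Type} (R : Set (Rule F)) (contrary : F → F) (S A : Set F) : Prop :=
  ∀ A' ⊆ A, ∀ Γ ⊆ S, ∀ φ ∈ A', ∀ ψ ∈ A',
    (Ded R (A' ∪ Γ) (contrary ψ) ↔ Ded R ((A' \ {φ}) ∪ {ψ} ∪ Γ) (contrary φ))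

theorem SeqDer.cut_finset {F : Type} [DecidableEq F] {R : Set (Rule F)} {AS T : Set F}
    {Δ : Finset F} (L : Finset F)
    (hL : ∀ ψ ∈ L, ∃ Γ : Finset F, ↑Γ ⊆ T ∧ SeqDer R AS ∅ Γ {ψ}) :
    ∀ G : Finset F, ↑G ⊆ T → SeqDer R AS ∅ (L ∪ G) Δ →
      ∃ Γ : Finset F, ↑Γ ⊆ T ∧ SeqDer R AS ∅ Γ Δ := by
  induction L using Finset.induction_on with
  | empty => exact fun G hG h => ⟨G, hG, by simpa using h⟩
  | insert a L _ ih =>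
    intro G hG h
    obtain ⟨Γ, hΓ, hd⟩ := hL a (Finset.mem_insert_self a L)
    refine ih (fun ψ hψ => hL ψ (Finset.mem_insert_of_mem hψ)) (Γ ∪ G) ?_ ?_
    · simpa using ⟨hΓ, hG⟩
    · rw [Finset.insert_union] at h
      have hcut := SeqDer.cutLhs (Δ₁ := ∅) (by simpa using hd) h
      simpa [Finset.union_left_comm] using hcut

theorem Ded.exists_seqDer {F : Type} [DecidableEq F] {R : Set (Rule F)} (AS : Set F)
    {T : Set F} {φ : F} (h : Ded R T φ) :
    ∃ Γ : Finset F, ↑Γ ⊆ T ∧ SeqDer R AS ∅ Γ {φ} := by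
  induction h with
  | @mem φ hφ => exact ⟨{φ}, by simpa using hφ, SeqDer.id φ⟩
  | @app l φ hr _ ih =>
    refine SeqDer.cut_finset l.toFinset (fun ψ hψ => ih ψ (List.mem_toFinset.1 hψ)) ∅ (by simp) ?_
    simpa using SeqDer.mu hr

theorem SeqDer.move_finset {F : Type} [DecidableEq F] {R : Set (Rule F)} {AS : Set F}
    {G Δ : Finset F} (B : Finset F) (hB : ↑B ⊆ AS) :
    ∀ A' : Finset F, SeqDer R AS A' (B ∪ G) Δ → SeqDer R AS (B ∪ A') G Δ := by
  induction B using Finset.induction_on with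
  | empty => exact fun A' h => by simpa using h
  | insert a B _ ih =>
    intro A' h
    rw [Finset.coe_insert, Set.insert_subset_iff] at hB
    rw [Finset.insert_union] at h
    simpa using ih hB.2 (insert a A') (SeqDer.toAss hB.1 h)

/-- Every deduction from assumptions and strict premises is witnessed by a sequent argument. -/
theorem Ded.exists_isSeqArg {F : Type} [DecidableEq F] {R : Set (Rule F)} {S A X Γ : Set F}
    {φ : F} (hX : X ⊆ A) (hΓ : Γ ⊆ S) (h : Ded R (X ∪ Γ) φ) :
    ∃ a : Argu F, IsSeqArg R S A a ∧ ↑a.ass ⊆ X ∧ a.concl = φ := by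
  classical
  obtain ⟨G, hG, hd⟩ := h.exists_seqDer A
  have hass : ↑(G.filter (· ∈ X)) ⊆ X := fun x hx => by simpa using (Finset.mem_filter.1 hx).2
  refine ⟨⟨G.filter (· ∈ X), G.filter (· ∉ X), φ⟩, ⟨hass.trans hX, ?_, ?_⟩, hass, rfl⟩
  · intro x hx
    obtain ⟨hxG, hxX⟩ := Finset.mem_filter.1 hx
    exact hΓ ((hG hxG).resolve_left hxX)
  · have hmove := SeqDer.move_finset (G := G.filter (· ∉ X)) (G.filter (· ∈ X)) (hass.trans hX) ∅
      (by rwa [Finset.filter_union_filter_not_eq])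
    simpa using hmove

/-- Lemma 4.17: for any complete extension `E` of the sequent-based ABA-framework,
the set `ass(E)` of all assumptions occurring in the assumption components of
arguments in `E` is consistent. -/
theorem stmt6 {F V : Type} [DecidableEq F]
    (R : Set (Rule F)) (S A : Set F) (contrary : F → F) (atoms : F → Set V)
    (hA : A.Nonempty) (hSA : S ∩ A = ∅)
    (hNT : ∀ φ : F, (∀ s ∈ S, Disjoint (atoms φ) (atoms s)) → ¬ Ded R S φ)
    (E : Set (Argu F))
    (hE : CompleteExt {a | IsSeqArg R S A a} (Attacks contrary) E) :
    ConsistentSet R contrary S (⋃ a ∈ E, (a.ass : Set F)) := by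
  rintro ⟨φ, hφ, X, hX, Γ, hΓ, hd⟩
  obtain ⟨⟨⟨hEArgs, hcf⟩, hdef⟩, hcomp⟩ := hE
  have hEA : (⋃ a ∈ E, (a.ass : Set F)) ⊆ A := Set.iUnion₂_subset fun a ha => (hEArgs ha).1
  obtain ⟨a, ha, haX, hac⟩ := Ded.exists_isSeqArg (hX.trans hEA) hΓ hd
  have haE : a ∈ E := by
    refine hcomp a ha ?_
    rintro b hb ⟨ψ, hψ, hbψ⟩
    obtain ⟨c, hc, hψc⟩ := Set.mem_iUnion₂.1 (hX (haX hψ))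
    exact hdef c hc b hb ⟨ψ, hψc, hbψ⟩
  obtain ⟨c, hc, hφc⟩ := Set.mem_iUnion₂.1 hφ
  exact hcf a haE c hc ⟨φ, hφc, hac⟩
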